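/- arXiv:2006.08485 — 8 statements merged into one kernel-verified Lean document; each statement's English description precedes it below -/
import Mathlib

section
/- Let δ↑ : (−d↓∞, ∞) → ℝ and δ↓ : (−d↑∞, ∞) → ℝ be strictly increasing, concave, differentiable functions with finite limits d↑∞ = lim_{T→∞} δ↑(T) and d↓∞ = lim_{T→∞} δ↓(T), satisfying the involution property −δ↑(−δ↓(T)) = T and −δ↓(−δ↑(T)) = T on their domains, and strict causality δ↑(0) > 0 and δ↓(0) > 0. Then there exists a unique real number δ_min such that δ↑(−δ_min) = δ_min = δ↓(−δ_min), and this δ_min is strictly positive. -/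
open Set Filter

/-- A strictly causal involution channel: two strictly increasing, concave,
differentiable delay functions `δu : (-dd, ∞) → (-∞, du)` and
`δd : (-du, ∞) → (-∞, dd)` with finite limits `du`, `dd` at `+∞`,
satisfying the involution property and strict causality. -/
structure InvolutionChannel where
  δu : ℝ → ℝ
  δd : ℝ → ℝ
  du : ℝ
  dd : ℝ
  du_pos : 0 < du
  dd_pos : 0 < dd
  mono_u : StrictMonoOn δu (Set.Ioi (-dd))
  mono_d : StrictMonoOn δd (Set.Ioi (-du))
  concave_u : ConcaveOn ℝ (Set.Ioi (-dd)) δu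
  concave_d : ConcaveOn ℝ (Set.Ioi (-du)) δd
  diff_u : DifferentiableOn ℝ δu (Set.Ioi (-dd))
  diff_d : DifferentiableOn ℝ δd (Set.Ioi (-du))
  maps_u : ∀ T ∈ Set.Ioi (-dd), δu T < du
  maps_d : ∀ T ∈ Set.Ioi (-du), δd T < dd
  lim_u : Filter.Tendsto δu Filter.atTop (nhds du)
  lim_d : Filter.Tendsto δd Filter.atTop (nhds dd)
  inv_ud : ∀ T ∈ Set.Ioi (-du), -δu (-δd T) = T
  inv_du : ∀ T ∈ Set.Ioi (-dd), -δd (-δu T) = T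
  causal_u : 0 < δu 0
  causal_d : 0 < δd 0

/-- `m` is the (unique, positive) value with `δu (-m) = m = δd (-m)`. -/
def InvolutionChannel.IsDeltaMin (C : InvolutionChannel) (m : ℝ) : Prop :=
  0 < m ∧ -m ∈ Set.Ioi (-C.dd) ∧ -m ∈ Set.Ioi (-C.du) ∧
    C.δu (-m) = m ∧ C.δd (-m) = m

/-- a strictly causal involution channel has a unique `δ_min` with
`δu (-δ_min) = δ_min = δd (-δ_min)`, and this `δ_min` is strictly positive. -/
theorem delta_min_exists_unique_pos (C : InvolutionChannel) :
    ∃ m : ℝ, 0 < m ∧ -m ∈ Set.Ioi (-C.dd) ∧ -m ∈ Set.Ioi (-C.du) ∧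
      C.δu (-m) = m ∧ C.δd (-m) = m ∧
      ∀ m' : ℝ, -m' ∈ Set.Ioi (-C.dd) → -m' ∈ Set.Ioi (-C.du) →
        C.δu (-m') = m' → C.δd (-m') = m' → m' = m := by
  have h0 : (0 : ℝ) ∈ Set.Ioi (-C.du) := neg_lt_zero.mpr C.du_pos
  have hb : C.δd 0 < C.dd := C.maps_d 0 h0
  have hcont : ContinuousOn (fun x => C.δu (-x) - x) (Set.Icc 0 (C.δd 0)) := by
    refine (C.diff_u.continuousOn.comp continuousOn_neg fun x hx => ?_).sub continuousOn_id
    exact neg_lt_neg (hx.2.trans_lt hb)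
  have hzero : C.δu (-C.δd 0) = 0 := neg_eq_zero.mp (C.inv_ud 0 h0)
  have hu := C.causal_u
  have hd := C.causal_d
  obtain ⟨m, hm, hfix⟩ := intermediate_value_Icc' hd.le hcont
    (show (0 : ℝ) ∈ _ from ⟨by simp only [hzero]; linarith, by simpa using hu.le⟩)
  have hum : C.δu (-m) = m := sub_eq_zero.mp hfix
  have hmd : -m ∈ Set.Ioi (-C.dd) := neg_lt_neg (hm.2.trans_lt hb)
  have hmu : m < C.du := hum ▸ C.maps_u (-m) hmd
  have hdm : C.δd (-m) = m := by
    have h := C.inv_du (-m) hmd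
    rw [hum] at h
    exact neg_injective h
  have hpos : 0 < m := by
    refine hm.1.lt_of_ne fun h => ?_
    rw [← h, neg_zero] at hum
    exact hu.ne' hum
  refine ⟨m, hpos, hmd, neg_lt_neg hmu, hum, hdm, fun m' hmd' _ hum' _ => ?_⟩
  rcases lt_trichotomy m' m with h | h | h
  · have := C.mono_u hmd hmd' (neg_lt_neg h)
    linarith
  · exact h
  · have := C.mono_u hmd' hmd (neg_lt_neg h)
    linarith
end

section
/- Fix real parameters τ > 0, T_p, and 0 < V̄ < 1, and define the exp-channel delay functions δ↑(T) = τ·ln(1 − e^{−(T + T_p − τ·ln V̄)/τ}) + T_p − τ·ln(1 − V̄) and δ↓(T) = τ·ln(1 − e^{−(T + T_p − τ·ln(1 − V̄))/τ}) + T_p − τ·ln V̄, on the domains where the argument of the outer logarithm is positive. Then these functions satisfy the involution property: −δ↑(−δ↓(T)) = T for all T in the domain of δ↓, and −δ↓(−δ↑(T)) = T for all T in the domain of δ↑. -/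
open Set Filter

/-- Exp-channel rising delay function:
`δ↑(T) = τ·ln(1 − e^{−(T + T_p − τ·ln V̄)/τ}) + T_p − τ·ln(1 − V̄)`. -/
noncomputable def expDelayUp (τ Tp V T : ℝ) : ℝ :=
  τ * Real.log (1 - Real.exp (-(T + Tp - τ * Real.log V) / τ)) +
    Tp - τ * Real.log (1 - V)

/-- Exp-channel falling delay function:
`δ↓(T) = τ·ln(1 − e^{−(T + T_p − τ·ln(1 − V̄))/τ}) + T_p − τ·ln V̄`. -/
noncomputable def expDelayDown (τ Tp V T : ℝ) : ℝ :=
  τ * Real.log (1 - Real.exp (-(T + Tp - τ * Real.log (1 - V)) / τ)) +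
    Tp - τ * Real.log V

/-- The cancellation behind the involution property, with the two threshold offsets
`a` and `b` arbitrary. -/
theorem neg_log_one_sub_exp_involution {τ : ℝ} (hτ : τ ≠ 0) (c a b T : ℝ)
    (h : Real.exp (-(T + c - τ * a) / τ) < 1) :
    -(τ * Real.log (1 - Real.exp
        (-(-(τ * Real.log (1 - Real.exp (-(T + c - τ * a) / τ)) + c - τ * b) + c - τ * b) / τ)) +
      c - τ * a) = T := by
  have key : ∀ L : ℝ, -(-(τ * L + c - τ * b) + c - τ * b) / τ = L := by
    intro L
    field_simp
    ring
  rw [key, Real.exp_log (sub_pos.mpr h), sub_sub_cancel, Real.log_exp, mul_div_cancel₀ _ hτ]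
  ring

/-- the exp-channel delay functions satisfy the involution
property `−δ↑(−δ↓(T)) = T` on the domain of `δ↓` and `−δ↓(−δ↑(T)) = T` on the
domain of `δ↑`. -/
theorem expDelay_involution (τ Tp V : ℝ) (hτ : 0 < τ) (hV0 : 0 < V) (hV1 : V < 1) :
    (∀ T : ℝ, Real.exp (-(T + Tp - τ * Real.log (1 - V)) / τ) < 1 →
      -expDelayUp τ Tp V (-expDelayDown τ Tp V T) = T) ∧
    (∀ T : ℝ, Real.exp (-(T + Tp - τ * Real.log V) / τ) < 1 →
      -expDelayDown τ Tp V (-expDelayUp τ Tp V T) = T) := by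
  exact ⟨fun T h => neg_log_one_sub_exp_involution hτ.ne' Tp (Real.log (1 - V)) (Real.log V) T h,
    fun T h => neg_log_one_sub_exp_involution hτ.ne' Tp (Real.log V) (Real.log (1 - V)) T h⟩
end

section
/- Fix real parameters τ > 0, T_p, and 0 < V̄ < 1, and let δ↑ and δ↓ be the exp-channel delay functions with these parameters. Then δ↑ and δ↓ are strictly increasing and strictly concave on their domains. -/
open Set Filter

theorem strictMonoOn_log_one_sub_exp (τ c d e : ℝ) (hτ : 0 < τ) :
    StrictMonoOn
      (fun T : ℝ => τ * Real.log (1 - Real.exp (-(T + c - d) / τ)) + c - e)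
      {T : ℝ | Real.exp (-(T + c - d) / τ) < 1} := by
  intro x hx y _ hxy
  rw [mem_ofPred_eq] at hx
  have hexp : Real.exp (-(y + c - d) / τ) < Real.exp (-(x + c - d) / τ) := by
    rw [Real.exp_lt_exp]
    gcongr
  have hlog : Real.log (1 - Real.exp (-(x + c - d) / τ)) <
      Real.log (1 - Real.exp (-(y + c - d) / τ)) :=
    Real.log_lt_log (by linarith) (by linarith)
  have := mul_lt_mul_of_pos_left hlog hτ
  dsimp only
  linarith

theorem strictConcaveOn_log_one_sub_exp (τ c d e : ℝ) (hτ : 0 < τ) :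
    StrictConcaveOn ℝ {T : ℝ | Real.exp (-(T + c - d) / τ) < 1}
      (fun T : ℝ => τ * Real.log (1 - Real.exp (-(T + c - d) / τ)) + c - e) := by
  have hdom : {T : ℝ | Real.exp (-(T + c - d) / τ) < 1} = Ioi (d - c) := by
    ext T
    rw [mem_ofPred_eq, Real.exp_lt_one_iff, div_lt_iff₀ hτ, mem_Ioi]
    constructor <;> intro h <;> linarith
  refine ⟨hdom ▸ convex_Ioi _, ?_⟩
  intro x hx y hy hxy a b ha hb hab
  rw [mem_ofPred_eq] at hx hy
  have hne : -(x + c - d) / τ ≠ -(y + c - d) / τ := by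
    intro h
    rw [div_left_inj' hτ.ne'] at h
    exact hxy (by linarith)
  have harg : -(a * x + b * y + c - d) / τ =
      a * (-(x + c - d) / τ) + b * (-(y + c - d) / τ) := by
    obtain rfl : b = 1 - a := by linarith
    ring
  have hexp := strictConvexOn_exp.2 (mem_univ _) (mem_univ _) hne ha hb hab
  have hlog := strictConcaveOn_log_Ioi.concaveOn.2
    (mem_Ioi.2 (sub_pos.2 hx)) (mem_Ioi.2 (sub_pos.2 hy)) ha.le hb.le hab
  simp only [smul_eq_mul] at hexp hlog ⊢
  rw [harg]
  have hpos : 0 < a * (1 - Real.exp (-(x + c - d) / τ)) +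
      b * (1 - Real.exp (-(y + c - d) / τ)) :=
    add_pos (mul_pos ha (sub_pos.2 hx)) (mul_pos hb (sub_pos.2 hy))
  have hlt := mul_lt_mul_of_pos_left
    (hlog.trans_lt (Real.log_lt_log hpos (y := 1 - Real.exp
      (a * (-(x + c - d) / τ) + b * (-(y + c - d) / τ))) (by linarith))) hτ
  obtain rfl : b = 1 - a := by linarith
  linarith

/-- the exp-channel delay functions are strictly increasing and
strictly concave on their domains. -/
theorem expDelay_strictMono_strictConcave (τ Tp V : ℝ) (hτ : 0 < τ)
    (hV0 : 0 < V) (hV1 : V < 1) :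
    StrictMonoOn (expDelayUp τ Tp V)
      {T : ℝ | Real.exp (-(T + Tp - τ * Real.log V) / τ) < 1} ∧
    StrictConcaveOn ℝ
      {T : ℝ | Real.exp (-(T + Tp - τ * Real.log V) / τ) < 1}
      (expDelayUp τ Tp V) ∧
    StrictMonoOn (expDelayDown τ Tp V)
      {T : ℝ | Real.exp (-(T + Tp - τ * Real.log (1 - V)) / τ) < 1} ∧
    StrictConcaveOn ℝ
      {T : ℝ | Real.exp (-(T + Tp - τ * Real.log (1 - V)) / τ) < 1}
      (expDelayDown τ Tp V) := by
  exact ⟨strictMonoOn_log_one_sub_exp τ Tp _ _ hτ,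
    strictConcaveOn_log_one_sub_exp τ Tp _ _ hτ,
    strictMonoOn_log_one_sub_exp τ Tp _ _ hτ,
    strictConcaveOn_log_one_sub_exp τ Tp _ _ hτ⟩
end

section
/- Let δ↑ and δ↓ be the delay functions of a strictly causal involution channel with δ_min the unique positive value satisfying δ↑(−δ_min) = δ_min = δ↓(−δ_min), and let η⁺, η⁻ ≥ 0 satisfy constraint (C): η⁺ + η⁻ < δ↓(−η⁺) − δ_min. Define h(τ) = δ↓(η⁺ − τ) + δ↑(−η⁻ − τ) − τ. Then h(η⁺ + δ_min) > 0; equivalently, δ↑(−η⁺ − η⁻ − δ_min) > η⁺. -/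
open Set Filter

/-- under constraint (C), with `h(τ) = δ↓(η⁺−τ) + δ↑(−η⁻−τ) − τ`,
one has `h(η⁺ + δ_min) > 0`; equivalently `δ↑(−η⁺−η⁻−δ_min) > η⁺`. -/
theorem h_pos_at_left_endpoint (C : InvolutionChannel) (δmin ηp ηm : ℝ)
    (hm : C.IsDeltaMin δmin) (hηp : 0 ≤ ηp) (hηm : 0 ≤ ηm)
    (hmemη : -ηp ∈ Set.Ioi (-C.du))
    (hC : ηp + ηm < C.δd (-ηp) - δmin) :
    0 < C.δd (ηp - (ηp + δmin)) + C.δu (-ηm - (ηp + δmin)) - (ηp + δmin) ∧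
    ηp < C.δu (-ηp - ηm - δmin) := by
  obtain ⟨-, -, -, -, hd⟩ := hm
  have hlt : C.δd (-ηp) < C.dd := C.maps_d _ hmemη
  have hinv : -C.δu (-C.δd (-ηp)) = -ηp := C.inv_ud _ hmemη
  have hmono : C.δu (-C.δd (-ηp)) < C.δu (-ηp - ηm - δmin) :=
    C.mono_u (by simp only [Set.mem_Ioi]; linarith) (by simp only [Set.mem_Ioi]; linarith)
      (by linarith)
  have key : ηp < C.δu (-ηp - ηm - δmin) := by linarith
  refine ⟨?_, key⟩
  rw [show ηp - (ηp + δmin) = -δmin by ring,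
    show -ηm - (ηp + δmin) = -ηp - ηm - δmin by ring, hd]
  linarith
end

section
/- Let δ↑ and δ↓ be the (continuous) delay functions of a strictly causal involution channel with δ_min the unique positive value satisfying δ↑(−δ_min) = δ_min = δ↓(−δ_min), and let η⁺, η⁻ ≥ 0 satisfy constraint (C): η⁺ + η⁻ < δ↓(−η⁺) − δ_min. Then there exists a real number τ with η⁺ + δ_min < τ < min(−η⁻ + d↓∞, η⁺ + d↑∞) satisfying the fixed-point equation δ↓(η⁺ − τ) + δ↑(−η⁻ − τ) = τ. -/
open Set Filter

namespace InvolutionChannel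

/-- Near the left end of its domain, `δu` takes arbitrarily small values. -/
lemma exists_δu_eq_neg (C : InvolutionChannel) {a b : ℝ} (ha : a < C.dd) (hb : -C.du < b) :
    ∃ x, a < x ∧ x < C.dd ∧ ∃ S, b < S ∧ C.δu (-x) = -S := by
  obtain ⟨S, hS, hbS⟩ := ((C.lim_d.eventually (lt_mem_nhds ha)).and (eventually_gt_atTop b)).exists
  have hSm : S ∈ Ioi (-C.du) := hb.trans hbS
  exact ⟨C.δd S, hS, C.maps_d S hSm, S, hbS, by linarith [C.inv_ud S hSm]⟩

/-- Near the left end of its domain, `δd` takes arbitrarily small values. -/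
lemma exists_δd_eq_neg (C : InvolutionChannel) {a b : ℝ} (ha : a < C.du) (hb : -C.dd < b) :
    ∃ x, a < x ∧ x < C.du ∧ ∃ S, b < S ∧ C.δd (-x) = -S := by
  obtain ⟨S, hS, hbS⟩ := ((C.lim_u.eventually (lt_mem_nhds ha)).and (eventually_gt_atTop b)).exists
  have hSm : S ∈ Ioi (-C.dd) := hb.trans hbS
  exact ⟨C.δu S, hS, C.maps_u S hSm, S, hbS, by linarith [C.inv_du S hSm]⟩

end InvolutionChannel

/-- under constraint (C) there exists a fixed point `τ` with
`η⁺ + δ_min < τ < min(−η⁻ + d↓∞, η⁺ + d↑∞)` satisfying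
`δ↓(η⁺ − τ) + δ↑(−η⁻ − τ) = τ`. -/
theorem fixed_point_tau_exists (C : InvolutionChannel) (δmin ηp ηm : ℝ)
    (hm : C.IsDeltaMin δmin) (hηp : 0 ≤ ηp) (hηm : 0 ≤ ηm)
    (hmemη : -ηp ∈ Set.Ioi (-C.du))
    (hC : ηp + ηm < C.δd (-ηp) - δmin) :
    ∃ τ : ℝ, ηp + δmin < τ ∧ τ < min (-ηm + C.dd) (ηp + C.du) ∧
      C.δd (ηp - τ) + C.δu (-ηm - τ) = τ := by
  obtain ⟨hpos, hmd, hmu, -, hδd⟩ := hm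
  have hdd := C.maps_d _ hmemη
  have hdu := C.du_pos
  have hdd0 := C.dd_pos
  rw [mem_Ioi] at hmd hmu
  set τ₀ := ηp + δmin with hτ₀
  set M := min (-ηm + C.dd) (ηp + C.du) with hM
  have hMd : M ≤ -ηm + C.dd := min_le_left _ _
  have hMu : M ≤ ηp + C.du := min_le_right _ _
  have hτ₀M : τ₀ < M := lt_min (by linarith) (by linarith)
  have memd : ∀ τ, τ < M → ηp - τ ∈ Ioi (-C.du) := fun τ h => by rw [mem_Ioi]; linarith
  have memu : ∀ τ, τ < M → -ηm - τ ∈ Ioi (-C.dd) := fun τ h => by rw [mem_Ioi]; linarith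
  set f : ℝ → ℝ := fun τ => C.δd (ηp - τ) + C.δu (-ηm - τ) - τ with hf
  have hf₀ : 0 < f τ₀ := by
    have h := C.mono_u (show -C.δd (-ηp) ∈ Ioi (-C.dd) by rw [mem_Ioi]; linarith)
      (memu τ₀ hτ₀M) (by linarith)
    have h₁ := C.inv_ud _ hmemη
    have h₂ : ηp - τ₀ = -δmin := by ring
    simp only [hf, h₂, hδd]
    linarith
  obtain ⟨τ₁, h₀₁, h₁M, hf₁⟩ : ∃ τ₁, τ₀ < τ₁ ∧ τ₁ < M ∧ f τ₁ < 0 := by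
    rcases le_total (-ηm + C.dd) (ηp + C.du) with h | h
    · have hMe : M = -ηm + C.dd := min_eq_left h
      obtain ⟨x, hx, hx', S, hS, hxS⟩ := C.exists_δu_eq_neg (a := ηm + τ₀) (b := C.dd)
        (by linarith) (by linarith)
      have hlt : x - ηm < M := by linarith
      refine ⟨x - ηm, by linarith, hlt, ?_⟩
      have h₁ := C.maps_d _ (memd _ hlt)
      have h₂ : -ηm - (x - ηm) = -x := by ring
      simp only [hf, h₂, hxS]
      linarith
    · have hMe : M = ηp + C.du := min_eq_right h
      obtain ⟨x, hx, hx', S, hS, hxS⟩ := C.exists_δd_eq_neg (a := τ₀ - ηp) (b := C.du)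
        (by linarith) (by linarith)
      have hlt : ηp + x < M := by linarith
      refine ⟨ηp + x, by linarith, hlt, ?_⟩
      have h₁ := C.maps_u _ (memu _ hlt)
      have h₂ : ηp - (ηp + x) = -x := by ring
      simp only [hf, h₂, hxS]
      linarith
  have hcont : ContinuousOn f (Icc τ₀ τ₁) := by
    refine ((C.diff_d.continuousOn.comp (by fun_prop) ?_).add
      (C.diff_u.continuousOn.comp (by fun_prop) ?_)).sub continuousOn_id
    · exact fun τ hτ => memd τ (hτ.2.trans_lt h₁M)
    · exact fun τ hτ => memu τ (hτ.2.trans_lt h₁M)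
  obtain ⟨τ, hτ, hfτ⟩ := intermediate_value_Ioo' h₀₁.le hcont ⟨hf₁, hf₀⟩
  exact ⟨τ, hτ.1, hτ.2.trans h₁M, sub_eq_zero.mp hfτ⟩
end

section
/- Let δ↑ and δ↓ be the delay functions of a strictly causal involution channel with δ_min the unique positive value satisfying δ↑(−δ_min) = δ_min = δ↓(−δ_min), let η⁺, η⁻ ≥ 0, and suppose τ satisfies η⁺ + δ_min < τ < min(−η⁻ + d↓∞, η⁺ + d↑∞) and δ↓(η⁺ − τ) + δ↑(−η⁻ − τ) = τ. Define Δ = δ↓(η⁺ − τ). Then 0 < Δ < δ_min, τ = η⁺ + δ↑(−Δ), and Δ is a fixed point of the worst-case pulse-length map f, i.e., f(Δ) = δ↓(Δ − η⁺ − δ↑(−Δ)) + Δ − η⁻ − η⁺ − δ↑(−Δ) = Δ. -/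
open Set Filter

/-- The worst-case pulse-length map
`f(x) = δ↓(x − η⁺ − δ↑(−x)) + x − η⁻ − η⁺ − δ↑(−x)`. -/
def InvolutionChannel.wcMap (C : InvolutionChannel) (ηp ηm x : ℝ) : ℝ :=
  C.δd (x - ηp - C.δu (-x)) + x - ηm - ηp - C.δu (-x)

/-- if `τ` satisfies `η⁺ + δ_min < τ < min(−η⁻ + d↓∞, η⁺ + d↑∞)`
and `δ↓(η⁺ − τ) + δ↑(−η⁻ − τ) = τ`, then `Δ = δ↓(η⁺ − τ)` satisfies
`0 < Δ < δ_min`, `τ = η⁺ + δ↑(−Δ)`, and `Δ` is a fixed point of the worst-case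
pulse-length map `f`. -/
theorem fixed_point_Delta (C : InvolutionChannel) (δmin ηp ηm τ Δ : ℝ)
    (hm : C.IsDeltaMin δmin) (hηp : 0 ≤ ηp) (hηm : 0 ≤ ηm)
    (hτ1 : ηp + δmin < τ) (hτ2 : τ < min (-ηm + C.dd) (ηp + C.du))
    (hfix : C.δd (ηp - τ) + C.δu (-ηm - τ) = τ)
    (hΔ : Δ = C.δd (ηp - τ)) :
    0 < Δ ∧ Δ < δmin ∧ τ = ηp + C.δu (-Δ) ∧
    C.wcMap ηp ηm Δ = Δ := by
  obtain ⟨hpos, -, -, hu, hd⟩ := hm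
  obtain ⟨hτdd, hτdu⟩ := lt_min_iff.mp hτ2
  have mem_d : ηp - τ ∈ Set.Ioi (-C.du) := by rw [Set.mem_Ioi]; linarith
  have mem_u : -ηm - τ ∈ Set.Ioi (-C.dd) := by rw [Set.mem_Ioi]; linarith
  have mem_d' : -δmin ∈ Set.Ioi (-C.du) := by rw [Set.mem_Ioi]; linarith
  have mem_u' : -δmin ∈ Set.Ioi (-C.dd) := by rw [Set.mem_Ioi]; linarith
  have lt_d := C.mono_d mem_d mem_d' (by linarith)
  have lt_u := C.mono_u mem_u mem_u' (by linarith)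
  have inv_d := C.inv_ud _ mem_d
  have inv_u := C.inv_du _ mem_u
  rw [← hΔ] at inv_d lt_d hfix
  rw [show -C.δu (-ηm - τ) = Δ - τ by linarith] at inv_u
  refine ⟨by linarith, by linarith, by linarith, ?_⟩
  rw [InvolutionChannel.wcMap, show Δ - ηp - C.δu (-Δ) = Δ - τ by linarith]
  linarith
end

section
/- Let δ↑ and δ↓ be the delay functions of a strictly causal involution channel and η⁺, η⁻ ≥ 0. For every Δ₁ > 0 in the domain of the worst-case pulse-length map f(x) = δ↓(x − η⁺ − δ↑(−x)) + x − η⁻ − η⁺ − δ↑(−x), the derivative satisfies f'(Δ₁) = (1 + δ↑'(−Δ₁))·(1 + δ↓'(Δ₁ − η⁺ − δ↑(−Δ₁))) ≥ 1 + δ↑'(0). -/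
open Set Filter

/-- for every `Δ₁ > 0` in the domain of the worst-case
pulse-length map `f`, one has
`f'(Δ₁) = (1 + δ↑'(−Δ₁))·(1 + δ↓'(Δ₁ − η⁺ − δ↑(−Δ₁))) ≥ 1 + δ↑'(0)`. -/
theorem wcMap_deriv (C : InvolutionChannel) (ηp ηm : ℝ)
    (hηp : 0 ≤ ηp) (hηm : 0 ≤ ηm) :
    ∀ Δ₁ : ℝ, 0 < Δ₁ → -Δ₁ ∈ Set.Ioi (-C.dd) →
      Δ₁ - ηp - C.δu (-Δ₁) ∈ Set.Ioi (-C.du) →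
      deriv (C.wcMap ηp ηm) Δ₁ =
        (1 + deriv C.δu (-Δ₁)) * (1 + deriv C.δd (Δ₁ - ηp - C.δu (-Δ₁))) ∧
      1 + deriv C.δu 0 ≤ deriv (C.wcMap ηp ηm) Δ₁ := by
  intro Δ hΔ hu hd
  have h0 : (0 : ℝ) ∈ Ioi (-C.dd) := neg_lt_zero.mpr C.dd_pos
  have hDu : HasDerivAt C.δu (deriv C.δu (-Δ)) (-Δ) :=
    (C.diff_u.differentiableAt (Ioi_mem_nhds hu)).hasDerivAt
  have hDd : HasDerivAt C.δd (deriv C.δd (Δ - ηp - C.δu (-Δ))) (Δ - ηp - C.δu (-Δ)) :=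
    (C.diff_d.differentiableAt (Ioi_mem_nhds hd)).hasDerivAt
  have hneg : HasDerivAt (fun x => C.δu (-x)) (deriv C.δu (-Δ) * -1) Δ :=
    HasDerivAt.comp Δ hDu (hasDerivAt_neg Δ)
  have hcomp : HasDerivAt (fun x => C.δd (x - ηp - C.δu (-x))) _ Δ :=
    HasDerivAt.comp Δ hDd (((hasDerivAt_id' Δ).sub_const ηp).sub hneg)
  have hf : deriv (C.wcMap ηp ηm) Δ =
      (1 + deriv C.δu (-Δ)) * (1 + deriv C.δd (Δ - ηp - C.δu (-Δ))) := by
    have h : HasDerivAt (C.wcMap ηp ηm) _ Δ :=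
      (((hcomp.add (hasDerivAt_id' Δ)).sub_const ηm).sub_const ηp).sub hneg
    rw [h.deriv]
    ring
  have hanti : deriv C.δu 0 ≤ deriv C.δu (-Δ) :=
    C.concave_u.antitoneOn_deriv
      (fun x hx => C.diff_u.differentiableAt (Ioi_mem_nhds hx)) hu h0 (neg_nonpos.mpr hΔ.le)
  have hu_nonneg : 0 ≤ deriv C.δu (-Δ) := by
    rw [← derivWithin_of_isOpen isOpen_Ioi hu]
    exact C.mono_u.monotoneOn.derivWithin_nonneg
  have hd_nonneg : 0 ≤ deriv C.δd (Δ - ηp - C.δu (-Δ)) := by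
    rw [← derivWithin_of_isOpen isOpen_Ioi hd]
    exact C.mono_d.monotoneOn.derivWithin_nonneg
  refine ⟨hf, ?_⟩
  rw [hf]
  nlinarith [mul_nonneg hu_nonneg hd_nonneg]
end

section
/- Let δ↑ and δ↓ be the delay functions of a strictly causal involution channel, η⁺, η⁻ ≥ 0, and let f(x) = δ↓(x − η⁺ − δ↑(−x)) + x − η⁻ − η⁺ − δ↑(−x) be the worst-case pulse-length map. If Δ > 0 is a fixed point of f (f(Δ) = Δ) and Δ₁ > Δ lies in the domain of f with the whole interval [Δ, Δ₁] contained in that domain, then f(Δ₁) − Δ ≥ (1 + δ↑'(0))·(Δ₁ − Δ). -/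
open Set Filter

/-- For a concave function, the derivative at the right of an interval bounds from below the
increment over that interval. -/
theorem ConcaveOn.deriv_mul_sub_le_sub {S : Set ℝ} {g : ℝ → ℝ} (hg : ConcaveOn ℝ S g) {a b c : ℝ}
    (ha : a ∈ S) (hc : c ∈ S) (hab : a < b) (hbc : b < c) (hd : DifferentiableAt ℝ g c) :
    deriv g c * (b - a) ≤ g b - g a := by
  have hb : b ∈ S := hg.1.ordConnected.out ha hc ⟨hab.le, hbc.le⟩
  have tangent := hg.deriv_le_slope hb hc hbc hd
  rw [slope_def_field] at tangent
  have chord := hg.slope_anti_adjacent ha hc hab hbc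
  rw [← le_div_iff₀ (sub_pos.2 hab)]
  exact tangent.trans chord

/-- if `Δ > 0` is a fixed point of the worst-case pulse-length
map `f` and `Δ₁ > Δ` with `[Δ, Δ₁]` contained in the domain of `f`, then
`f(Δ₁) − Δ ≥ (1 + δ↑'(0))·(Δ₁ − Δ)`. -/
theorem wcMap_expansion (C : InvolutionChannel) (ηp ηm Δ Δ₁ : ℝ)
    (hηp : 0 ≤ ηp) (hηm : 0 ≤ ηm)
    (hΔpos : 0 < Δ) (hfix : C.wcMap ηp ηm Δ = Δ) (hlt : Δ < Δ₁)
    (hdom : ∀ x ∈ Set.Icc Δ Δ₁,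
      -x ∈ Set.Ioi (-C.dd) ∧ x - ηp - C.δu (-x) ∈ Set.Ioi (-C.du)) :
    (1 + deriv C.δu 0) * (Δ₁ - Δ) ≤ C.wcMap ηp ηm Δ₁ - Δ := by
  have h₀ : (0 : ℝ) ∈ Set.Ioi (-C.dd) := neg_lt_zero.2 C.dd_pos
  obtain ⟨hu, hv⟩ := hdom Δ (left_mem_Icc.2 hlt.le)
  obtain ⟨hu₁, hv₁⟩ := hdom Δ₁ (right_mem_Icc.2 hlt.le)
  have increment := C.concave_u.deriv_mul_sub_le_sub hu₁ h₀ (neg_lt_neg hlt)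
    (neg_lt_zero.2 hΔpos) (C.diff_u.differentiableAt (Ioi_mem_nhds h₀))
  have hu_le : C.δu (-Δ₁) ≤ C.δu (-Δ) :=
    C.mono_u.monotoneOn hu₁ hu (neg_le_neg hlt.le)
  have hd_le := C.mono_d.monotoneOn hv hv₁ (by linarith)
  unfold InvolutionChannel.wcMap at hfix ⊢
  linarith
end
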